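/- Let (X,Y) be centered Gaussian with unit variances and correlation r, and let (X',Y') be centered Gaussian with unit variances and correlation ρ ≥ r. Then for any a,b ∈ ℝ: P[X > a, Y > b] ≤ P[X' > a, Y' > b] (Slepian comparison for bivariate upper orthants). -/

import Mathlib

open MeasureTheory Filter Topology

open ProbabilityTheory in
lemma complexMGF_eq_aux {Ω Ω' : Type*} [MeasurableSpace Ω] [MeasurableSpace Ω']
    {μ : Measure Ω} {μ' : Measure Ω'} [IsProbabilityMeasure μ] {X : Ω → ℝ} {Y : Ω' → ℝ}
    (h : mgf X μ = mgf Y μ') (hpos : ∀ t, 0 < mgf X μ t) :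
    complexMGF X μ = complexMGF Y μ' := by
  have huniv : integrableExpSet X μ = Set.univ := by
    ext t
    simp only [Set.mem_univ, iff_true]
    exact mgf_pos_iff.1 (hpos t)
  funext z
  exact eqOn_complexMGF_of_mgf h (by simp [huniv])

open ProbabilityTheory in
lemma ext_of_laplace_aux {μ μ' : Measure (ℝ × ℝ)} [IsProbabilityMeasure μ]
    [IsProbabilityMeasure μ'] (f : ℝ → ℝ → ℝ)
    (hμ : ∀ u v : ℝ, ∫ p, Real.exp (u * p.1 + v * p.2) ∂μ = Real.exp (f u v))
    (hμ' : ∀ u v : ℝ, ∫ p, Real.exp (u * p.1 + v * p.2) ∂μ' = Real.exp (f u v)) :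
    μ = μ' := by
  apply Measure.ext_of_charFunDual
  funext L
  have hL : ∀ p : ℝ × ℝ, L p = L (1, 0) * p.1 + L (0, 1) * p.2 := by
    intro p
    have : p = p.1 • ((1 : ℝ), (0 : ℝ)) + p.2 • ((0 : ℝ), (1 : ℝ)) := by ext <;> simp
    conv_lhs => rw [this]
    rw [map_add, map_smul, map_smul]
    simp [mul_comm]
  have key : ∀ ν : Measure (ℝ × ℝ),
      (∀ u v : ℝ, ∫ p, Real.exp (u * p.1 + v * p.2) ∂ν = Real.exp (f u v)) →
      ∀ t, mgf L ν t = Real.exp (f (t * L (1, 0)) (t * L (0, 1))) := by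
    intro ν hν t
    rw [← hν, mgf]
    congr 1
    funext p
    beta_reduce
    rw [hL p]
    ring_nf
  have h := complexMGF_eq_aux (X := L) (Y := L) (μ := μ) (μ' := μ')
    (by funext t; rw [key μ hμ, key μ' hμ'])
    (by intro t; rw [key μ hμ]; exact Real.exp_pos _)
  have h1 := congrFun h Complex.I
  simp only [complexMGF] at h1
  simp only [charFunDual_apply]
  simpa [mul_comm] using h1

lemma corr_bounds_aux (r : ℝ) (μ : Measure (ℝ × ℝ)) [IsProbabilityMeasure μ]
    (hμ : ∀ u v : ℝ, ∫ p, Real.exp (u * p.1 + v * p.2) ∂μ =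
      Real.exp ((u ^ 2 + v ^ 2 + 2 * r * u * v) / 2)) : -1 ≤ r ∧ r ≤ 1 := by
  have hint : ∀ u v : ℝ, Integrable (fun p : ℝ × ℝ => Real.exp (u * p.1 + v * p.2)) μ := by
    intro u v
    by_contra hn
    have := hμ u v
    rw [integral_undef hn] at this
    exact (Real.exp_pos _).ne this
  have key : ∀ v : ℝ, v ^ 2 = 1 → 0 ≤ 1 + r * v := by
    intro v hv
    have h2 : (2 : ℝ) ≤ ∫ p, (Real.exp (1 * p.1 + v * p.2) +
        Real.exp ((-1) * p.1 + (-v) * p.2)) ∂μ := by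
      have : (2 : ℝ) = ∫ _p : ℝ × ℝ, (2 : ℝ) ∂μ := by simp
      rw [this]
      apply integral_mono (integrable_const _) ((hint _ _).add (hint _ _))
      intro p
      have h1 := Real.add_one_le_exp (1 * p.1 + v * p.2)
      have h2 := Real.add_one_le_exp ((-1) * p.1 + (-v) * p.2)
      simp only [Pi.add_apply]
      linarith
    rw [integral_add (hint _ _) (hint _ _), hμ, hμ] at h2
    have e1 : ((1:ℝ) ^ 2 + v ^ 2 + 2 * r * 1 * v) / 2 = 1 + r * v := by rw [hv]; ring
    have e2 : ((-1:ℝ) ^ 2 + (-v) ^ 2 + 2 * r * (-1) * (-v)) / 2 = 1 + r * v := by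
      rw [neg_sq v, hv]; ring
    rw [e1, e2] at h2
    exact Real.one_le_exp_iff.1 (by linarith)
  have h1 := key 1 (by norm_num)
  have h2 := key (-1) (by norm_num)
  constructor <;> linarith

open ProbabilityTheory in
lemma repr_aux (r s : ℝ) (hs : r ^ 2 + s ^ 2 = 1) (μ : Measure (ℝ × ℝ)) [IsProbabilityMeasure μ]
    (hμ : ∀ u v : ℝ, ∫ p, Real.exp (u * p.1 + v * p.2) ∂μ =
      Real.exp ((u ^ 2 + v ^ 2 + 2 * r * u * v) / 2)) :
    μ = ((gaussianReal 0 1).prod (gaussianReal 0 1)).map (fun q => (q.1, r * q.1 + s * q.2)) := by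
  have hm : Measurable (fun q : ℝ × ℝ => (q.1, r * q.1 + s * q.2)) := by fun_prop
  have : IsProbabilityMeasure (((gaussianReal 0 1).prod (gaussianReal 0 1)).map
    (fun q : ℝ × ℝ => (q.1, r * q.1 + s * q.2))) := Measure.isProbabilityMeasure_map hm.aemeasurable
  refine ext_of_laplace_aux _ hμ ?_
  intro u v
  rw [integral_map hm.aemeasurable (by fun_prop)]
  have hg : ∀ t : ℝ, ∫ x, Real.exp (t * x) ∂(gaussianReal 0 1) = Real.exp (t ^ 2 / 2) := by
    intro t
    have := congrFun (mgf_fun_id_gaussianReal (μ := 0) (v := 1)) t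
    simpa [mgf] using this
  have e : ∀ q : ℝ × ℝ, Real.exp (u * q.1 + v * (r * q.1 + s * q.2)) =
      Real.exp ((u + v * r) * q.1) * Real.exp ((v * s) * q.2) := by
    intro q
    rw [← Real.exp_add]; ring_nf
  simp only [e]
  rw [integral_prod_mul (fun x => Real.exp ((u + v * r) * x)) (fun x => Real.exp ((v * s) * x)),
    hg, hg, ← Real.exp_add]
  congr 1
  linear_combination (v ^ 2 / 2) * hs

/-- Single crossing of the conditional half-lines. -/
lemma crossing_aux (r ρ b : ℝ) (hr : -1 ≤ r) (hρ : ρ ≤ 1) (hlt : r < ρ) :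
    ∃ x0 : ℝ, (∀ x z : ℝ, x0 < x → b < r * x + √(1 - r ^ 2) * z → b < ρ * x + √(1 - ρ ^ 2) * z) ∧
      (∀ x z : ℝ, x < x0 → b < ρ * x + √(1 - ρ ^ 2) * z → b < r * x + √(1 - r ^ 2) * z) := by
  rcases eq_or_lt_of_le hρ with h1 | h1
  · subst h1
    refine ⟨b, fun x z h _ => ?_, fun x z h h' => ?_⟩
    · simpa using h
    · simp at h'; linarith
  rcases eq_or_lt_of_le hr with h2 | h2
  · subst h2
    refine ⟨-b, fun x z h h' => ?_, fun x z h h' => ?_⟩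
    · simp at h'; linarith
    · simp; linarith
  have hs : 0 < √(1 - r ^ 2) := Real.sqrt_pos.2 (by nlinarith)
  have hs' : 0 < √(1 - ρ ^ 2) := Real.sqrt_pos.2 (by nlinarith)
  have es : √(1 - r ^ 2) ^ 2 = 1 - r ^ 2 := Real.sq_sqrt (by nlinarith)
  have es' : √(1 - ρ ^ 2) ^ 2 = 1 - ρ ^ 2 := Real.sq_sqrt (by nlinarith)
  set s := √(1 - r ^ 2)
  set s' := √(1 - ρ ^ 2)
  have hD : 0 < ρ * s - r * s' := by
    by_contra hn
    push Not at hn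
    rcases le_or_gt 0 r with h0 | h0
    · have : (ρ * s) ^ 2 ≤ (r * s') ^ 2 :=
        pow_le_pow_left₀ (mul_nonneg (by linarith) hs.le) (by linarith) 2
      rw [mul_pow, mul_pow, es, es'] at this
      nlinarith
    · rcases le_or_gt ρ 0 with h3 | h3
      · have : (-r * s') ^ 2 ≤ (-ρ * s) ^ 2 :=
          pow_le_pow_left₀ (mul_nonneg (by linarith) hs'.le) (by linarith) 2
        rw [mul_pow, mul_pow, es, es'] at this
        nlinarith
      · nlinarith [mul_pos h3 hs, mul_pos (neg_pos.2 h0) hs']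
  refine ⟨b * (s - s') / (ρ * s - r * s'), fun x z h h' => ?_, fun x z h h' => ?_⟩
  · rw [div_lt_iff₀ hD] at h
    have := mul_lt_mul_of_pos_left h' hs'
    refine lt_of_mul_lt_mul_left (a := s) ?_ hs.le
    linarith
  · rw [lt_div_iff₀ hD] at h
    have := mul_lt_mul_of_pos_left h' hs
    refine lt_of_mul_lt_mul_left (a := s') ?_ hs'.le
    linarith

/-- Slepian comparison for bivariate upper orthants: if `μ` and `μ'` are centered bivariate
Gaussian laws with unit variances and correlations `r ≤ ρ` respectively (characterized by
their Laplace transforms), then `P[X > a, Y > b] ≤ P[X' > a, Y' > b]`. -/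
theorem slepian_bivariate (r ρ : ℝ) (hrρ : r ≤ ρ)
    (μ μ' : Measure (ℝ × ℝ)) [IsProbabilityMeasure μ] [IsProbabilityMeasure μ']
    (hμ : ∀ u v : ℝ, ∫ p, Real.exp (u * p.1 + v * p.2) ∂μ =
      Real.exp ((u ^ 2 + v ^ 2 + 2 * r * u * v) / 2))
    (hμ' : ∀ u v : ℝ, ∫ p, Real.exp (u * p.1 + v * p.2) ∂μ' =
      Real.exp ((u ^ 2 + v ^ 2 + 2 * ρ * u * v) / 2))
    (a b : ℝ) :
    μ {p : ℝ × ℝ | a < p.1 ∧ b < p.2} ≤ μ' {p : ℝ × ℝ | a < p.1 ∧ b < p.2} := by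
  classical
  obtain ⟨hr1, hr2⟩ := corr_bounds_aux r μ hμ
  obtain ⟨hρ1, hρ2⟩ := corr_bounds_aux ρ μ' hμ'
  rcases eq_or_lt_of_le hrρ with heq | hlt
  · subst heq
    rw [ext_of_laplace_aux _ hμ hμ']
  have hsnd : μ.map Prod.snd = μ'.map Prod.snd := by
    have e1 : ∀ t, ProbabilityTheory.mgf Prod.snd μ t = Real.exp (t ^ 2 / 2) := by
      intro t; simpa [ProbabilityTheory.mgf] using hμ 0 t
    have e2 : ∀ t, ProbabilityTheory.mgf Prod.snd μ' t = Real.exp (t ^ 2 / 2) := by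
      intro t; simpa [ProbabilityTheory.mgf] using hμ' 0 t
    refine Measure.ext_of_complexMGF_eq measurable_snd.aemeasurable measurable_snd.aemeasurable
      (complexMGF_eq_aux (by funext t; rw [e1, e2]) ?_)
    intro t; rw [e1]; exact Real.exp_pos _
  have hmarg : μ {p : ℝ × ℝ | b < p.2} = μ' {p : ℝ × ℝ | b < p.2} := by
    have := congrArg (fun m => m (Set.Ioi b)) hsnd
    simp only [Measure.map_apply measurable_snd measurableSet_Ioi] at this
    exact this
  have hR := repr_aux r (√(1 - r ^ 2)) (by rw [Real.sq_sqrt (by nlinarith)]; ring) μ hμ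
  have hR' := repr_aux ρ (√(1 - ρ ^ 2)) (by rw [Real.sq_sqrt (by nlinarith)]; ring) μ' hμ'
  obtain ⟨x0, hx1, hx2⟩ := crossing_aux r ρ b hr1 hρ2 hlt
  have hm : ∀ r s : ℝ, Measurable (fun q : ℝ × ℝ => (q.1, r * q.1 + s * q.2)) := by
    intro r s; fun_prop
  have hA : MeasurableSet {p : ℝ × ℝ | a < p.1} := measurableSet_lt measurable_const measurable_fst
  have hB : MeasurableSet {p : ℝ × ℝ | b < p.2} := measurableSet_lt measurable_const measurable_snd
  have hset : {p : ℝ × ℝ | a < p.1 ∧ b < p.2} = {p | b < p.2} ∩ {p | a < p.1} := by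
    ext p; simp [and_comm]
  rw [hset]
  rcases le_or_gt x0 a with hle | hgt
  · rw [hR, hR', Measure.map_apply (hm _ _) (hB.inter hA), Measure.map_apply (hm _ _) (hB.inter hA)]
    apply measure_mono
    rintro ⟨x, z⟩ ⟨h1, h2⟩
    simp only [Set.mem_setOf_eq] at h1 h2
    exact ⟨hx1 x z (by linarith) h1, h2⟩
  · have hc : μ' ({p | b < p.2} \ {p | a < p.1}) ≤ μ ({p | b < p.2} \ {p | a < p.1}) := by
      rw [hR, hR', Measure.map_apply (hm _ _) (hB.diff hA), Measure.map_apply (hm _ _) (hB.diff hA)]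
      apply measure_mono
      rintro ⟨x, z⟩ ⟨h1, h2⟩
      simp only [Set.mem_setOf_eq, not_lt] at h1 h2
      exact ⟨hx2 x z (by linarith) h1, by simpa using h2⟩
    have s1 := measure_inter_add_diff (μ := μ) {p : ℝ × ℝ | b < p.2} hA
    have s2 := measure_inter_add_diff (μ := μ') {p : ℝ × ℝ | b < p.2} hA
    rw [hmarg, ← s2] at s1
    refine (ENNReal.add_le_add_iff_right (measure_ne_top μ ({p | b < p.2} \ {p | a < p.1}))).1 ?_
    rw [s1]
    gcongr
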